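/- arXiv:math/9806169 — 3 statements merged into one kernel-verified Lean document; each statement's English description precedes it below -/
import Mathlib

section
/- Let R be a commutative local ring with maximal ideal m in which 2 is a unit, let D = [[1,0],[0,-1]], and let M ∈ GL₂(R) with det M ≡ 1 (mod m). If D·M·D = M⁻¹, then det M = 1, the diagonal entries of M are equal (M₀₀ = M₁₁), and (M₀₀)² = 1 + M₀₁·M₁₀. -/
open Matrix

/-- In a commutative local ring `R` in which `2` is a unit, if `M ∈ GL₂(R)` has
`det M ≡ 1 (mod m)` and is inverted by conjugation by `D = diag(1,-1)`, then `det M = 1`,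
`M₀₀ = M₁₁` and `M₀₀² = 1 + M₀₁ M₁₀`. -/
theorem stmt_4 (R : Type*) [CommRing R] [IsLocalRing R] (h2 : IsUnit (2 : R))
    (M : GL (Fin 2) R)
    (hdet : (M : Matrix (Fin 2) (Fin 2) R).det - 1 ∈ IsLocalRing.maximalIdeal R)
    (h : !![1, 0; 0, -1] * (M : Matrix (Fin 2) (Fin 2) R) * !![1, 0; 0, -1] =
      ((M⁻¹ : GL (Fin 2) R) : Matrix (Fin 2) (Fin 2) R)) :
    (M : Matrix (Fin 2) (Fin 2) R).det = 1 ∧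
    (M : Matrix (Fin 2) (Fin 2) R) 0 0 = (M : Matrix (Fin 2) (Fin 2) R) 1 1 ∧
    ((M : Matrix (Fin 2) (Fin 2) R) 0 0) ^ 2 =
      1 + (M : Matrix (Fin 2) (Fin 2) R) 0 1 * (M : Matrix (Fin 2) (Fin 2) R) 1 0 := by
  have hinv : !![1, 0; 0, -1] * (M : Matrix (Fin 2) (Fin 2) R) * !![1, 0; 0, -1] *
      (M : Matrix (Fin 2) (Fin 2) R) = 1 := by
    rw [h, ← Units.val_mul, inv_mul_cancel, Units.val_one]
  have hsq : ((M : Matrix (Fin 2) (Fin 2) R).det - 1) *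
      ((M : Matrix (Fin 2) (Fin 2) R).det + 1) = 0 := by
    have hd := congrArg Matrix.det hinv
    simp only [det_mul, det_one, det_fin_two_of] at hd
    linear_combination hd
  have hunit : IsUnit ((M : Matrix (Fin 2) (Fin 2) R).det + 1) := by
    by_contra hn
    have hmem := sub_mem ((IsLocalRing.mem_maximalIdeal _).2 hn) hdet
    exact (IsLocalRing.mem_maximalIdeal _).1 (by convert hmem using 1; ring) h2
  have hone : (M : Matrix (Fin 2) (Fin 2) R).det = 1 :=
    sub_eq_zero.1 (hunit.mul_left_eq_zero.1 hsq)
  generalize (M : Matrix (Fin 2) (Fin 2) R) = A at hinv hone ⊢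
  have h00 := congrFun₂ hinv 0 0
  have h01 := congrFun₂ hinv 0 1
  simp [vecMul, dotProduct, Matrix.mul_apply, Fin.sum_univ_two] at h00 h01
  have hd := hone
  rw [det_fin_two] at hd
  refine ⟨hone, ?_, by linear_combination h00⟩
  linear_combination (A 1 1) * (h00 - hd) - (A 1 0) * h01 - (A 0 0 - A 1 1) * hd
end

section
/- Let R be a commutative ring, u, v ∈ R units, s = diag(u,v), and let T : GL₂(R) → GL₂(R) be the map T(x) = s·x·s⁻¹·x⁻¹. Then for every k ≥ 1 and every U ∈ R, the k-fold iterate satisfies T^k([[1,U],[0,1]]) = [[1, (u·v⁻¹ - 1)^k·U],[0,1]]. -/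
open Matrix

/-- The commutator of `diag(u,v)` with the unipotent matrix `[[1,a],[0,1]]` is the unipotent
matrix with upper right entry `(u v⁻¹ - 1) a`. -/
theorem coe_commutator_diagonal_unipotent {R : Type*} [CommRing R] (u v : Rˣ)
    (s y : GL (Fin 2) R) (a : R)
    (hs : (s : Matrix (Fin 2) (Fin 2) R) = !![(u : R), 0; 0, (v : R)])
    (hy : (y : Matrix (Fin 2) (Fin 2) R) = !![1, a; 0, 1]) :
    ((s * y * s⁻¹ * y⁻¹ : GL (Fin 2) R) : Matrix (Fin 2) (Fin 2) R) =
      !![1, ((u : R) * (↑v⁻¹ : R) - 1) * a; 0, 1] := by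
  have hs' : ((s⁻¹ : GL (Fin 2) R) : Matrix (Fin 2) (Fin 2) R) =
      !![(↑u⁻¹ : R), 0; 0, (↑v⁻¹ : R)] :=
    Units.inv_eq_of_mul_eq_one_right (by rw [hs]; simp [Matrix.one_fin_two])
  have hy' : ((y⁻¹ : GL (Fin 2) R) : Matrix (Fin 2) (Fin 2) R) = !![1, -a; 0, 1] :=
    Units.inv_eq_of_mul_eq_one_right (by rw [hy]; simp [Matrix.one_fin_two])
  rw [Units.val_mul, Units.val_mul, Units.val_mul, hs, hy, hs', hy']
  simp only [Matrix.mul_fin_two, mul_zero, zero_mul, add_zero, zero_add, mul_one,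
    Units.mul_inv]
  congr 3
  ring_nf

/-- For `s = diag(u,v) ∈ GL₂(R)` with `u, v` units and `T(x) = s x s⁻¹ x⁻¹`, the `k`-fold
iterate of `T` on `[[1,U],[0,1]]` is `[[1, (u v⁻¹ - 1)^k U],[0,1]]` for every `k ≥ 1`. -/
theorem stmt_13 (R : Type*) [CommRing R] (u v : Rˣ) (s : GL (Fin 2) R)
    (hs : (s : Matrix (Fin 2) (Fin 2) R) = !![(u : R), 0; 0, (v : R)])
    (k : ℕ) (hk : 1 ≤ k) (U : R) (x : GL (Fin 2) R)
    (hx : (x : Matrix (Fin 2) (Fin 2) R) = !![1, U; 0, 1]) :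
    (((fun y : GL (Fin 2) R => s * y * s⁻¹ * y⁻¹)^[k] x : GL (Fin 2) R) :
        Matrix (Fin 2) (Fin 2) R) =
      !![1, ((u : R) * (↑v⁻¹ : R) - 1) ^ k * U; 0, 1] := by
  induction k, hk using Nat.le_induction with
  | base => simpa using coe_commutator_diagonal_unipotent u v s x U hs hx
  | succ n _ ih =>
    rw [Function.iterate_succ_apply', coe_commutator_diagonal_unipotent u v s _ _ hs ih,
      pow_succ', mul_assoc]
end

section
/- Let R be a commutative ring, a, b ∈ R, u, v ∈ R units, t = [[1,a],[0,1]] and g = [[u,b],[0,v]]. Then for every natural number q, t^q·(t·g·t⁻¹·g⁻¹) = [[1, a·(q + 1 - u·v⁻¹)],[0,1]]. In particular t^q·(t·g·t⁻¹·g⁻¹) is the identity matrix if and only if a·(q + 1 - u·v⁻¹) = 0. -/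
theorem unipotent_pow {R : Type*} [CommRing R] (a : R) (q : ℕ) :
    !![(1 : R), a; 0, 1] ^ q = !![1, (q : R) * a; 0, 1] := by
  induction q with
  | zero => simp [Matrix.one_fin_two]
  | succ n ih =>
    rw [pow_succ, ih, Matrix.mul_fin_two]
    push_cast
    congr! 3 <;> ring_nf

theorem upperTriangular_inv {R : Type*} [CommRing R] (b : R) (u v : Rˣ) :
    (!![(u : R), b; 0, (v : R)])⁻¹ =
      !![(↑u⁻¹ : R), -((↑u⁻¹ : R) * b * (↑v⁻¹ : R)); 0, (↑v⁻¹ : R)] := by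
  apply Matrix.inv_eq_right_inv
  rw [Matrix.mul_fin_two, Matrix.one_fin_two]
  simp [← mul_assoc]

theorem unipotent_inv {R : Type*} [CommRing R] (a : R) :
    (!![(1 : R), a; 0, 1])⁻¹ = !![1, -a; 0, 1] := by
  simpa using upperTriangular_inv a 1 1

/-- For `t = [[1,a],[0,1]]` and `g = [[u,b],[0,v]]` with `u, v` units, one has
`t^q (t g t⁻¹ g⁻¹) = [[1, a(q + 1 - u v⁻¹)],[0,1]]`, which is the identity iff
`a(q + 1 - u v⁻¹) = 0`. -/
theorem stmt_14 (R : Type*) [CommRing R] (a b : R) (u v : Rˣ) (q : ℕ) :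
    (!![(1 : R), a; 0, 1]) ^ q *
      (!![(1 : R), a; 0, 1] * !![(u : R), b; 0, (v : R)] * (!![(1 : R), a; 0, 1])⁻¹ *
        (!![(u : R), b; 0, (v : R)])⁻¹) =
      !![1, a * ((q : R) + 1 - (u : R) * (↑v⁻¹ : R)); 0, 1] ∧
    ((!![(1 : R), a; 0, 1]) ^ q *
      (!![(1 : R), a; 0, 1] * !![(u : R), b; 0, (v : R)] * (!![(1 : R), a; 0, 1])⁻¹ *
        (!![(u : R), b; 0, (v : R)])⁻¹) = 1 ↔
      a * ((q : R) + 1 - (u : R) * (↑v⁻¹ : R)) = 0) := by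
  have key : (!![(1 : R), a; 0, 1]) ^ q *
      (!![(1 : R), a; 0, 1] * !![(u : R), b; 0, (v : R)] * (!![(1 : R), a; 0, 1])⁻¹ *
        (!![(u : R), b; 0, (v : R)])⁻¹) =
      !![1, a * ((q : R) + 1 - (u : R) * (↑v⁻¹ : R)); 0, 1] := by
    have hu : (u : R) * ↑u⁻¹ = 1 := u.mul_inv
    have hv : (v : R) * ↑v⁻¹ = 1 := v.mul_inv
    rw [unipotent_pow, unipotent_inv, upperTriangular_inv]
    simp only [Matrix.mul_fin_two]
    ext i j
    fin_cases i <;> fin_cases j <;> simp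
    linear_combination (-b * ↑v⁻¹) * hu + a * hv
  refine ⟨key, ?_⟩
  rw [key, Matrix.one_fin_two]
  simp
end
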